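/- The function F(L) = √(det(Id + LᵀL)) on the space of linear maps L : ℝⁿ → ℝᵐ is convex on the convex set {L : ‖L‖_{op} ≤ 1} of distance-decreasing linear maps. -/

import Mathlib

open Matrix

section TraceInequality

variable {ι : Type*} [Fintype ι]

lemma Matrix.trace_transpose_mul_self_nonneg (Z : Matrix ι ι ℝ) : 0 ≤ trace (Zᵀ * Z) := by
  simpa [conjTranspose_eq_transpose_of_trivial] using
    (posSemidef_conjTranspose_mul_self Z).trace_nonneg

variable [DecidableEq ι]

/-- For orthogonal `U` and `V` with positive semidefinite symmetric part and `M` skew-symmetric,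
the bilinear form `trace ((1 + U) M (1 + V) M)` is nonpositive. -/
lemma Matrix.trace_one_add_orthogonal_mul_skew_nonpos {M U V : Matrix ι ι ℝ} (hM : Mᵀ = -M)
    (hU : Uᵀ * U = 1) (hV : Vᵀ * V = 1) (hU' : (U + Uᵀ).PosSemidef) (hV' : (V + Vᵀ).PosSemidef) :
    trace ((1 + U) * M * (1 + V) * M) ≤ 0 := by
  have symm_part {W : Matrix ι ι ℝ} (hW : (W + Wᵀ).PosSemidef) : trace (W * M * M) ≤ 0 := by
    have h := (hW.conjTranspose_mul_mul_same M).trace_nonneg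
    have ht : trace (M * Wᵀ * M) = trace (M * W * M) := by
      rw [← trace_transpose (M * W * M)]
      simp [transpose_mul, hM, Matrix.mul_assoc]
    rw [conjTranspose_eq_transpose_of_trivial, hM] at h
    simp only [Matrix.mul_add, Matrix.add_mul, Matrix.neg_mul, trace_add, trace_neg, ht] at h
    have hc : trace (W * M * M) = trace (M * W * M) := trace_mul_cycle W M M
    linarith
  have hcross : trace (U * M * V * M) ≤ -trace (M * M) := by
    have h := trace_transpose_mul_self_nonneg (U * M + M * Vᵀ)
    have h1 : trace (M * Uᵀ * M * Vᵀ) = trace (U * M * V * M) := by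
      rw [← trace_transpose]
      simp only [transpose_mul, transpose_transpose, hM, Matrix.mul_neg, Matrix.neg_mul, neg_neg]
      rw [← Matrix.mul_assoc, ← Matrix.mul_assoc, Matrix.mul_assoc (V * M), trace_mul_comm]
      simp only [Matrix.mul_assoc]
    have h2 : trace (V * M * U * M) = trace (U * M * V * M) := by
      rw [Matrix.mul_assoc (V * M), trace_mul_comm]
      simp only [Matrix.mul_assoc]
    have h3 : trace (M * Uᵀ * U * M) = trace (M * M) := by
      rw [Matrix.mul_assoc M, hU, Matrix.mul_one]
    have h4 : trace (V * M * M * Vᵀ) = trace (M * M) := by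
      rw [trace_mul_comm, ← Matrix.mul_assoc, ← Matrix.mul_assoc, hV, Matrix.one_mul]
    simp only [transpose_add, transpose_mul, transpose_transpose, hM, Matrix.add_mul,
      Matrix.mul_add, Matrix.neg_mul, Matrix.mul_neg, trace_add, trace_neg,
      ← Matrix.mul_assoc, h1, h2, h3, h4] at h
    linarith
  have hMM : trace (M * V * M) = trace (V * M * M) := (trace_mul_cycle V M M).symm
  have h1 := symm_part hU'
  have h2 := symm_part hV'
  simp only [Matrix.add_mul, Matrix.mul_add, Matrix.one_mul, Matrix.mul_one, trace_add, hMM]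
  linarith

/-- The determinant of `1 + K` does not vanish for `K` skew-symmetric. -/
lemma Matrix.isUnit_det_one_add_of_skew {K : Matrix ι ι ℝ} (hK : Kᵀ = -K) :
    IsUnit (1 + K).det := by
  have h : ((1 + K)ᵀ * (1 + K)).PosDef := by
    have : (1 + K)ᵀ * (1 + K) = 1 + Kᴴ * K := by
      rw [conjTranspose_eq_transpose_of_trivial, transpose_add, transpose_one, hK]
      noncomm_ring
    rw [this]
    exact PosDef.one.add_posSemidef (posSemidef_conjTranspose_mul_self K)
  have h' := h.det_pos
  rw [det_mul, det_transpose] at h'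
  exact isUnit_iff_ne_zero.2 fun h0 => by simp [h0] at h'

/-- The Cayley transform of a skew-symmetric contraction is orthogonal, and its symmetric part is
positive semidefinite. -/
lemma Matrix.cayley_skew_contraction {K : Matrix ι ι ℝ} (hK : Kᵀ = -K)
    (hK' : (1 - Kᵀ * K).PosSemidef) :
    ((2 : ℝ) • (1 + K)⁻¹ - 1)ᵀ * ((2 : ℝ) • (1 + K)⁻¹ - 1) = 1 ∧
      (((2 : ℝ) • (1 + K)⁻¹ - 1) + ((2 : ℝ) • (1 + K)⁻¹ - 1)ᵀ).PosSemidef := by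
  have hAP := mul_nonsing_inv _ (isUnit_det_one_add_of_skew hK)
  set P := (1 + K)⁻¹
  have hKP : K * P = 1 - P := by
    rw [Matrix.add_mul, Matrix.one_mul] at hAP
    exact eq_sub_of_add_eq' hAP
  have hPK : Pᵀ * Kᵀ = 1 - Pᵀ := by
    rw [← transpose_mul, hKP, transpose_sub, transpose_one]
  have hsum : P + Pᵀ = (2 : ℝ) • (Pᵀ * P) := by
    have h1 : Pᵀ * K * P = Pᵀ - Pᵀ * P := by
      rw [Matrix.mul_assoc, hKP, Matrix.mul_sub, Matrix.mul_one]
    have h2 : Pᵀ * Kᵀ * P = P - Pᵀ * P := by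
      rw [hPK, Matrix.sub_mul, Matrix.one_mul]
    rw [hK, Matrix.mul_neg, Matrix.neg_mul, h1] at h2
    rw [two_smul]
    linear_combination (norm := abel) -h2
  refine ⟨?_, ?_⟩
  · simp only [transpose_sub, transpose_smul, transpose_one, Matrix.sub_mul, Matrix.mul_sub,
      Matrix.one_mul, Matrix.mul_one, Matrix.smul_mul, Matrix.mul_smul, ← hsum]
    module
  · have h := (hK'.conjTranspose_mul_mul_same P).smul (zero_le_two (α := ℝ))
    have hform : Pᵀ * (1 - Kᵀ * K) * P = P + Pᵀ - 1 := by
      have : Pᵀ * (1 - Kᵀ * K) * P = Pᵀ * P - (Pᵀ * Kᵀ) * (K * P) := by noncomm_ring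
      rw [this, hPK, hKP]
      have : (1 - Pᵀ) * (1 - P) = 1 - (P + Pᵀ) + Pᵀ * P := by noncomm_ring
      rw [this, hsum, two_smul]
      abel
    rw [conjTranspose_eq_transpose_of_trivial, hform] at h
    convert h using 1
    simp only [transpose_sub, transpose_smul, transpose_one]
    module

lemma Matrix.trace_inv_one_add_skew_mul_nonpos {K₁ K₂ M : Matrix ι ι ℝ} (hM : Mᵀ = -M)
    (h₁ : K₁ᵀ = -K₁) (h₁' : (1 - K₁ᵀ * K₁).PosSemidef)
    (h₂ : K₂ᵀ = -K₂) (h₂' : (1 - K₂ᵀ * K₂).PosSemidef) :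
    trace ((1 + K₁)⁻¹ * M * (1 + K₂)⁻¹ * M) ≤ 0 := by
  obtain ⟨hU, hU'⟩ := cayley_skew_contraction h₁ h₁'
  obtain ⟨hV, hV'⟩ := cayley_skew_contraction h₂ h₂'
  have h := trace_one_add_orthogonal_mul_skew_nonpos hM hU hV hU' hV'
  simp only [add_sub_cancel, Matrix.smul_mul, Matrix.mul_smul, trace_smul, smul_eq_mul] at h
  linarith

end TraceInequality

section LogDet

variable {ι : Type*} [Fintype ι] [DecidableEq ι]

/-- Jacobi's formula along an affine line, at an invertible matrix. -/
lemma Matrix.hasDerivAt_det_add_smul {A M : Matrix ι ι ℝ} {t : ℝ}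
    (h : IsUnit (A + t • M).det) :
    HasDerivAt (fun s : ℝ => (A + s • M).det)
      ((A + t • M).det * trace ((A + t • M)⁻¹ * M)) t := by
  set B := A + t • M
  have hfac (s : ℝ) : A + s • M = B * (1 + (s - t) • (B⁻¹ * M)) := by
    rw [Matrix.mul_add, Matrix.mul_one, Matrix.mul_smul, mul_nonsing_inv_cancel_left _ _ h]
    module
  set p := (det (1 + (Polynomial.X : Polynomial ℝ) • (B⁻¹ * M).map Polynomial.C)).divX.divX
  have hdet : (fun s : ℝ => (A + s • M).det) = fun s : ℝ =>
      B.det * (1 + trace (B⁻¹ * M) * (s - t) + p.eval (s - t) * (s - t) ^ 2) :=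
    funext fun s => by rw [hfac, det_mul, det_one_add_smul]
  rw [hdet]
  refine HasDerivAt.const_mul _ ?_
  have hs : HasDerivAt (fun s : ℝ => s - t) 1 t := (hasDerivAt_id t).sub_const t
  have hp : HasDerivAt (fun s : ℝ => p.eval (s - t)) (p.derivative.eval (t - t) * 1) t :=
    HasDerivAt.comp (h₂ := fun y => p.eval y) t (p.hasDerivAt (t - t)) hs
  have := ((hs.const_mul (trace (B⁻¹ * M))).const_add 1).add (hp.mul (hs.pow 2))
  refine this.congr_deriv ?_
  simp

/-- Along a segment of skew-symmetric contractions, `log det (1 + ·)` is convex. -/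
lemma Matrix.convexOn_log_det_one_add_skew {K M : Matrix ι ι ℝ} (hK : Kᵀ = -K) (hM : Mᵀ = -M)
    {D : Set ℝ} (hD : Convex ℝ D)
    (hc : ∀ t ∈ D, (1 - (K + t • M)ᵀ * (K + t • M)).PosSemidef) :
    ConvexOn ℝ D (fun t : ℝ => Real.log (1 + (K + t • M)).det) := by
  have hskew (t : ℝ) : (K + t • M)ᵀ = -(K + t • M) := by
    rw [transpose_add, transpose_smul, hK, hM]
    module
  have hunit (t : ℝ) := isUnit_det_one_add_of_skew (hskew t)
  have hderiv (t : ℝ) : HasDerivAt (fun t : ℝ => Real.log (1 + (K + t • M)).det)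
      (trace ((1 + (K + t • M))⁻¹ * M)) t := by
    have h := hunit t
    simp only [← add_assoc] at h ⊢
    convert (hasDerivAt_det_add_smul h).log h.ne_zero using 1
    rw [mul_div_cancel_left₀ _ h.ne_zero]
  refine MonotoneOn.convexOn_of_deriv hD
    (fun t _ => (hderiv t).continuousAt.continuousWithinAt)
    (fun t _ => (hderiv t).differentiableAt.differentiableWithinAt) ?_
  intro s hs t ht hst
  rw [(hderiv s).deriv, (hderiv t).deriv]
  have hres : (1 + (K + s • M))⁻¹ - (1 + (K + t • M))⁻¹ =
      (t - s) • ((1 + (K + s • M))⁻¹ * M * (1 + (K + t • M))⁻¹) := by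
    have hM' : (t - s) • M = (1 + (K + t • M)) - (1 + (K + s • M)) := by module
    rw [← Matrix.smul_mul, ← Matrix.mul_smul, hM', Matrix.mul_sub, Matrix.sub_mul,
      mul_nonsing_inv_cancel_right _ _ (hunit t), nonsing_inv_mul _ (hunit s), Matrix.one_mul]
  have htr := trace_inv_one_add_skew_mul_nonpos hM (hskew s) (hc s (interior_subset hs))
    (hskew t) (hc t (interior_subset ht))
  have := congrArg (fun X => trace (X * M)) hres
  simp only [Matrix.sub_mul, Matrix.smul_mul, trace_sub, trace_smul, smul_eq_mul] at this
  nlinarith [mul_nonneg (sub_nonneg.2 hst) (neg_nonneg.2 htr)]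

end LogDet

section SkewBlock

variable {ι κ : Type*}

/-- The skew-symmetric block matrix with off-diagonal blocks `-Aᵀ` and `A`. -/
def Matrix.skewBlock (A : Matrix κ ι ℝ) : Matrix (ι ⊕ κ) (ι ⊕ κ) ℝ := fromBlocks 0 (-Aᵀ) A 0

lemma Matrix.skewBlock_transpose (A : Matrix κ ι ℝ) : A.skewBlockᵀ = -A.skewBlock := by
  simp [skewBlock, fromBlocks_transpose, fromBlocks_neg]

lemma Matrix.skewBlock_add_smul (A B : Matrix κ ι ℝ) (t : ℝ) :
    (A + t • B).skewBlock = A.skewBlock + t • B.skewBlock := by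
  simp [skewBlock, fromBlocks_add, fromBlocks_smul, add_comm]

variable [Fintype ι] [DecidableEq ι] [Fintype κ] [DecidableEq κ]

lemma Matrix.det_one_add_skewBlock (A : Matrix κ ι ℝ) :
    (1 + A.skewBlock).det = (1 + Aᵀ * A).det := by
  rw [skewBlock, ← fromBlocks_one, fromBlocks_add]
  simp [det_fromBlocks_one₂₂]

lemma Matrix.posSemidef_one_sub_skewBlock {A : Matrix κ ι ℝ}
    (h₁ : (1 - Aᵀ * A).PosSemidef) (h₂ : (1 - A * Aᵀ).PosSemidef) :
    (1 - A.skewBlockᵀ * A.skewBlock).PosSemidef := by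
  have hblock : 1 - A.skewBlockᵀ * A.skewBlock =
      fromBlocks (1 - Aᵀ * A) 0 0 (1 - A * Aᵀ) := by
    rw [skewBlock, fromBlocks_transpose, fromBlocks_multiply, ← fromBlocks_one,
      sub_eq_iff_eq_add, fromBlocks_add]
    simp
  rw [hblock]
  refine PosSemidef.of_dotProduct_mulVec_nonneg ?_ fun x => ?_
  · exact h₁.isHermitian.fromBlocks (by simp) h₂.isHermitian
  · rw [← Sum.elim_comp_inl_inr x, fromBlocks_mulVec]
    have := add_nonneg (h₁.dotProduct_mulVec_nonneg (x ∘ Sum.inl))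
      (h₂.dotProduct_mulVec_nonneg (x ∘ Sum.inr))
    simpa [dotProduct, Fintype.sum_sum_type] using this

end SkewBlock

section EuclideanMatrix

variable {ι κ : Type*} [Fintype ι] [DecidableEq ι] [Fintype κ]

lemma ContinuousLinearMap.toEuclideanLin_symm_adjoint [DecidableEq κ]
    (L : EuclideanSpace ℝ ι →L[ℝ] EuclideanSpace ℝ κ) :
    toEuclideanLin.symm (adjoint L).toLinearMap = (toEuclideanLin.symm L.toLinearMap)ᵀ := by
  rw [LinearEquiv.symm_apply_eq, ← conjTranspose_eq_transpose_of_trivial,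
    Matrix.toEuclideanLin_conjTranspose_eq_adjoint, LinearEquiv.apply_symm_apply,
    ContinuousLinearMap.adjoint_toLinearMap]

lemma ContinuousLinearMap.posSemidef_one_sub_of_norm_le_one
    {L : EuclideanSpace ℝ ι →L[ℝ] EuclideanSpace ℝ κ} (hL : ‖L‖ ≤ 1) :
    (1 - (toEuclideanLin.symm L.toLinearMap)ᵀ * toEuclideanLin.symm L.toLinearMap).PosSemidef := by
  set A := toEuclideanLin.symm L.toLinearMap with hA
  have hLA (x : EuclideanSpace ℝ ι) : (L x).ofLp = A *ᵥ x.ofLp := by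
    simp [hA, ← toLin'_apply, ← ofLp_toLpLin 2 2]
  refine PosSemidef.of_dotProduct_mulVec_nonneg ?_ fun x => ?_
  · simp [IsHermitian, conjTranspose_eq_transpose_of_trivial, transpose_sub, transpose_mul]
  · have h : ‖L (WithLp.toLp 2 x)‖ ≤ ‖WithLp.toLp 2 x‖ := by
      simpa using L.le_of_opNorm_le hL (WithLp.toLp 2 x)
    have h2 := pow_le_pow_left₀ (norm_nonneg _) h 2
    rw [← real_inner_self_eq_norm_sq, ← real_inner_self_eq_norm_sq,
      EuclideanSpace.inner_eq_star_dotProduct, EuclideanSpace.inner_eq_star_dotProduct, hLA] at h2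
    simp only [star_trivial, sub_mulVec, one_mulVec, dotProduct_sub, ← mulVec_mulVec,
      dotProduct_mulVec, vecMul_transpose] at h2 ⊢
    linarith

lemma ContinuousLinearMap.det_id_add_adjoint_comp [DecidableEq κ]
    (L : EuclideanSpace ℝ ι →L[ℝ] EuclideanSpace ℝ κ) :
    LinearMap.det ((ContinuousLinearMap.id ℝ (EuclideanSpace ℝ ι) +
      (adjoint L).comp L).toLinearMap) =
    (1 + (toEuclideanLin.symm L.toLinearMap)ᵀ * toEuclideanLin.symm L.toLinearMap).det := by
  rw [← LinearMap.det_toLpLin 2, ← L.toEuclideanLin_symm_adjoint, map_add, toLpLin_one,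
    toLpLin_mul_same]
  congr 1
  simp

end EuclideanMatrix

theorem volume_element_convex_on_distance_decreasing (n m : ℕ) :
    ConvexOn ℝ
      {L : EuclideanSpace ℝ (Fin n) →L[ℝ] EuclideanSpace ℝ (Fin m) | ‖L‖ ≤ 1}
      (fun L : EuclideanSpace ℝ (Fin n) →L[ℝ] EuclideanSpace ℝ (Fin m) =>
        Real.sqrt (LinearMap.det
          ((ContinuousLinearMap.id ℝ (EuclideanSpace ℝ (Fin n)) +
            (ContinuousLinearMap.adjoint L).comp L).toLinearMap))) := by
  have hconv : Convex ℝ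
      {L : EuclideanSpace ℝ (Fin n) →L[ℝ] EuclideanSpace ℝ (Fin m) | ‖L‖ ≤ 1} := by
    simpa [Metric.closedBall] using convex_closedBall
      (0 : EuclideanSpace ℝ (Fin n) →L[ℝ] EuclideanSpace ℝ (Fin m)) 1
  refine ⟨hconv, fun L₀ h₀ L₁ h₁ a b ha hb hab => ?_⟩
  set mat : (EuclideanSpace ℝ (Fin n) →L[ℝ] EuclideanSpace ℝ (Fin m)) → Matrix (Fin m) (Fin n) ℝ :=
    fun L => toEuclideanLin.symm L.toLinearMap with hmat
  set g : ℝ → ℝ := fun t =>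
    Real.log (1 + ((mat L₀).skewBlock + t • (mat (L₁ - L₀)).skewBlock)).det with hg
  have hline (t : ℝ) : (mat L₀).skewBlock + t • (mat (L₁ - L₀)).skewBlock =
      (mat (L₀ + t • (L₁ - L₀))).skewBlock := by
    rw [← skewBlock_add_smul]
    simp [hmat]
  have hvol (t : ℝ) : Real.sqrt (LinearMap.det
      ((ContinuousLinearMap.id ℝ (EuclideanSpace ℝ (Fin n)) +
        (ContinuousLinearMap.adjoint (L₀ + t • (L₁ - L₀))).comp
          (L₀ + t • (L₁ - L₀))).toLinearMap)) = Real.exp (g t / 2) := by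
    have hpos : 0 < (1 + (mat (L₀ + t • (L₁ - L₀)))ᵀ * mat (L₀ + t • (L₁ - L₀))).det := by
      rw [← conjTranspose_eq_transpose_of_trivial]
      exact (PosDef.one.add_posSemidef (posSemidef_conjTranspose_mul_self _)).det_pos
    rw [ContinuousLinearMap.det_id_add_adjoint_comp, hg]
    simp only [hline, det_one_add_skewBlock]
    rw [← Real.log_sqrt hpos.le, Real.exp_log (Real.sqrt_pos.2 hpos)]
  have hgconv : ConvexOn ℝ (Set.Icc 0 1) g := by
    refine convexOn_log_det_one_add_skew (skewBlock_transpose _) (skewBlock_transpose _)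
      (convex_Icc 0 1) fun t ht => ?_
    have hL : ‖L₀ + t • (L₁ - L₀)‖ ≤ 1 := hconv.add_smul_sub_mem h₀ h₁ ht
    rw [hline]
    refine posSemidef_one_sub_skewBlock
      (ContinuousLinearMap.posSemidef_one_sub_of_norm_le_one hL) ?_
    have h := ContinuousLinearMap.posSemidef_one_sub_of_norm_le_one
      (L := ContinuousLinearMap.adjoint (L₀ + t • (L₁ - L₀)))
      ((LinearIsometryEquiv.norm_map ContinuousLinearMap.adjoint _).trans_le hL)
    rwa [ContinuousLinearMap.toEuclideanLin_symm_adjoint, transpose_transpose] at h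
  have hab' : a • L₀ + b • L₁ = L₀ + b • (L₁ - L₀) := by
    rw [← eq_sub_iff_add_eq] at hab
    rw [hab]
    module
  have hv0 := hvol 0
  have hv1 := hvol 1
  rw [show L₀ + (0 : ℝ) • (L₁ - L₀) = L₀ by module] at hv0
  rw [show L₀ + (1 : ℝ) • (L₁ - L₀) = L₁ by module] at hv1
  beta_reduce
  rw [hab', hvol, hv0, hv1]
  have hg' := hgconv.2 (Set.left_mem_Icc.2 zero_le_one) (Set.right_mem_Icc.2 zero_le_one) ha hb hab
  simp only [smul_eq_mul, mul_zero, mul_one, zero_add] at hg'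
  calc Real.exp (g b / 2) ≤ Real.exp (a • (g 0 / 2) + b • (g 1 / 2)) :=
        Real.exp_le_exp.2 (by simp only [smul_eq_mul]; linarith)
    _ ≤ a • Real.exp (g 0 / 2) + b • Real.exp (g 1 / 2) :=
        convexOn_exp.2 (Set.mem_univ _) (Set.mem_univ _) ha hb hab
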